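/- Fix an integer n ≥ 2, a real B > 0, set A = −((n−2)/2)·√(B/(n−1)), f(r) = 1 − 2A/r² − B/r⁴ and r₀ = (B/(n−1))^{1/4}. Let ε ∈ {−1, 1}, t₁, φ₁ ∈ ℝ, and let φ₀, r₁ be real constants with r₁ > r₀·|φ₀|/2 and r₁ > 0. For r > r₀ define α(r) = arcsin √((4r₁²r² − 4r₀²r₁²)/(4r₁²r² − r₀⁴φ₀²)), k² = 1 − 1/n + r₀²φ₀²/(4n·r₁²), t(r) = t₁ + (ε/r₁)·[ 2r₁·√(r⁴ + (n−2)·r₀²·r² − B)/√(4r₁²r² − r₀⁴φ₀²) − √n·r₀·E(α(r), k²) + (r₀/√n)·F(α(r), k²) ], and φ(r) = φ₁ + (ε·r₀·φ₀/(√n·r₁))·F(α(r), k²). Then t and φ are differentiable on (r₀, ∞) with t'(r) = ε/(r₁·√((1 − r₀⁴φ₀²/(4r₁²r²))·f(r))) and φ'(r) = ε·r₀²·φ₀/(r₁·r²·√((1 − r₀⁴φ₀²/(4r₁²r²))·f(r))), and t(r) → t₁, φ(r) → φ₁ as r → r₀⁺. (This is the geodesic of the scalar-flat metric of Eguchi–Hanson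 type with θ ≡ π/2 and ψ constant, passing through the removable singularity r₀.) -/

import Mathlib

/-- Incomplete elliptic integral of the first kind. -/
noncomputable def ellF (a k2 : ℝ) : ℝ :=
  ∫ ρ in (0:ℝ)..a, 1 / Real.sqrt (1 - k2 * Real.sin ρ ^ 2)

/-- Incomplete elliptic integral of the second kind. -/
noncomputable def ellE (a k2 : ℝ) : ℝ :=
  ∫ ρ in (0:ℝ)..a, Real.sqrt (1 - k2 * Real.sin ρ ^ 2)

lemma aux_pos (k2 : ℝ) (h0 : 0 ≤ k2) (h1 : k2 < 1) (x : ℝ) : 0 < 1 - k2 * Real.sin x ^ 2 := by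
  have := Real.sin_sq_le_one x
  nlinarith [sq_nonneg (Real.sin x)]

lemma ellF_deriv (k2 : ℝ) (h0 : 0 ≤ k2) (h1 : k2 < 1) (a : ℝ) :
    HasDerivAt (fun a => ellF a k2) (1 / Real.sqrt (1 - k2 * Real.sin a ^ 2)) a := by
  have hc : Continuous (fun ρ : ℝ => 1 / Real.sqrt (1 - k2 * Real.sin ρ ^ 2)) := by
    refine Continuous.div continuous_const (by fun_prop) ?_
    intro x
    exact (Real.sqrt_pos.2 (aux_pos k2 h0 h1 x)).ne'
  exact intervalIntegral.integral_hasDerivAt_right (hc.intervalIntegrable _ _)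
    (hc.stronglyMeasurableAtFilter _ _) hc.continuousAt

lemma ellE_deriv (k2 : ℝ) (a : ℝ) :
    HasDerivAt (fun a => ellE a k2) (Real.sqrt (1 - k2 * Real.sin a ^ 2)) a := by
  have hc : Continuous (fun ρ : ℝ => Real.sqrt (1 - k2 * Real.sin ρ ^ 2)) := by
    fun_prop
  exact intervalIntegral.integral_hasDerivAt_right (hc.intervalIntegrable _ _)
    (hc.stronglyMeasurableAtFilter _ _) hc.continuousAt

lemma alg_aux (r r₀ r₁ M p q d s ε D P Q : ℝ) (hr : 0 < r) (hr₁ : 0 < r₁)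
    (hp : 0 < p) (hq : 0 < q) (hd : 0 < d) (hs : 0 < s)
    (e1 : d ^ 2 = D) (e3 : p ^ 2 = P) (e4 : q ^ 2 = Q) (h1 : p ^ 2 + r₀ ^ 2 = r ^ 2)
    (h2 : 4 * r₁ ^ 2 * p ^ 2 + r₀ ^ 2 * M = d ^ 2) :
    ε / r₁ * ((2 * r₁ * ((2 * r * Q + P * (2 * r)) / (2 * (p * q))) * d
      - 2 * r₁ * (p * q) * (4 * r₁ ^ 2 * (2 * r) / (2 * d))) / d ^ 2
      - s * r₀ * (2 * r₁ * r * r₀ * M * q / (s * D * d * p))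
      + r₀ / s * (2 * r₁ * r * r₀ * s / (d * p * q)))
    = ε / (r₁ * (d * p * q / (2 * r₁ * r ^ 3))) := by
  subst e1 e3 e4
  have hb : (q ^ 2 + p ^ 2) * d ^ 2 - 4 * r₁ ^ 2 * p ^ 2 * q ^ 2 - r₀ ^ 2 * M * q ^ 2
      + r₀ ^ 2 * d ^ 2 = r ^ 2 * d ^ 2 := by
    linear_combination d ^ 2 * h1 - q ^ 2 * h2
  have hR : ε / (r₁ * (d * p * q / (2 * r₁ * r ^ 3)))
      = ε * 2 * r / (d * p * q * d ^ 2) * (r ^ 2 * d ^ 2) := by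
    field_simp
  rw [hR, ← hb]
  field_simp

set_option maxHeartbeats 1600000 in
/-- geodesics of the scalar-flat metrics of Eguchi–Hanson type with
`θ ≡ π/2` and constant `ψ`, passing through the removable singularity `r₀`. -/
theorem stmt_9 (n : ℕ) (hn : 2 ≤ n) (B : ℝ) (hB : 0 < B)
    (A r₀ : ℝ)
    (hA : A = -(((n : ℝ) - 2) / 2) * Real.sqrt (B / ((n : ℝ) - 1)))
    (hr₀ : r₀ = (B / ((n : ℝ) - 1)) ^ ((1 : ℝ) / 4))
    (f : ℝ → ℝ) (hf : ∀ r, f r = 1 - 2 * A / r ^ 2 - B / r ^ 4)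
    (ε : ℝ) (hε : ε = 1 ∨ ε = -1) (t₁ φ₁ φ₀ r₁ : ℝ)
    (hr₁pos : 0 < r₁) (hr₁ : r₁ > r₀ * |φ₀| / 2)
    (α : ℝ → ℝ) (hα : ∀ r, α r = Real.arcsin (Real.sqrt
      ((4 * r₁ ^ 2 * r ^ 2 - 4 * r₀ ^ 2 * r₁ ^ 2) / (4 * r₁ ^ 2 * r ^ 2 - r₀ ^ 4 * φ₀ ^ 2))))
    (k2 : ℝ) (hk2 : k2 = 1 - 1 / (n : ℝ) + r₀ ^ 2 * φ₀ ^ 2 / (4 * (n : ℝ) * r₁ ^ 2))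
    (t φ : ℝ → ℝ)
    (ht : ∀ r, t r = t₁ + (ε / r₁) *
      (2 * r₁ * Real.sqrt (r ^ 4 + ((n : ℝ) - 2) * r₀ ^ 2 * r ^ 2 - B)
          / Real.sqrt (4 * r₁ ^ 2 * r ^ 2 - r₀ ^ 4 * φ₀ ^ 2)
        - Real.sqrt (n : ℝ) * r₀ * ellE (α r) k2
        + (r₀ / Real.sqrt (n : ℝ)) * ellF (α r) k2))
    (hφ : ∀ r, φ r = φ₁ + (ε * r₀ * φ₀ / (Real.sqrt (n : ℝ) * r₁)) * ellF (α r) k2) :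
    (∀ r, r₀ < r → HasDerivAt t
      (ε / (r₁ * Real.sqrt ((1 - r₀ ^ 4 * φ₀ ^ 2 / (4 * r₁ ^ 2 * r ^ 2)) * f r))) r)
    ∧ (∀ r, r₀ < r → HasDerivAt φ
      (ε * r₀ ^ 2 * φ₀ /
        (r₁ * r ^ 2 * Real.sqrt ((1 - r₀ ^ 4 * φ₀ ^ 2 / (4 * r₁ ^ 2 * r ^ 2)) * f r))) r)
    ∧ Filter.Tendsto t (nhdsWithin r₀ (Set.Ioi r₀)) (nhds t₁)
    ∧ Filter.Tendsto φ (nhdsWithin r₀ (Set.Ioi r₀)) (nhds φ₁) := by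
  have hnR : (2:ℝ) ≤ n := by exact_mod_cast hn
  have hn0 : (0:ℝ) < n := by linarith
  have hn1 : (0:ℝ) < (n:ℝ) - 1 := by linarith
  have hBn : 0 < B / ((n:ℝ) - 1) := div_pos hB hn1
  have hr0 : 0 < r₀ := by rw [hr₀]; exact Real.rpow_pos_of_pos hBn _
  have hr04 : r₀ ^ 4 = B / ((n:ℝ) - 1) := by
    rw [hr₀, ← Real.rpow_natCast, ← Real.rpow_mul hBn.le]; norm_num
  have hB' : B = ((n:ℝ) - 1) * r₀ ^ 4 := by rw [hr04]; field_simp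
  have hA' : A = -(((n:ℝ) - 2) / 2) * r₀ ^ 2 := by
    rw [hA, ← hr04, show r₀ ^ 4 = (r₀ ^ 2) ^ 2 by ring, Real.sqrt_sq (by positivity)]
  have hM : 0 < 4 * r₁ ^ 2 - r₀ ^ 2 * φ₀ ^ 2 := by
    have h1 : r₀ * |φ₀| < 2 * r₁ := by linarith
    have h2 : (r₀ * |φ₀|) ^ 2 < (2 * r₁) ^ 2 := by
      apply pow_lt_pow_left₀ h1 (by positivity) (by norm_num)
    rw [mul_pow, sq_abs] at h2
    nlinarith
  set M := 4 * r₁ ^ 2 - r₀ ^ 2 * φ₀ ^ 2 with hMdef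
  have hk0 : 0 ≤ k2 := by
    rw [hk2]
    have : 1 / (n:ℝ) ≤ 1 := by rw [div_le_one hn0]; linarith
    have : 0 ≤ r₀ ^ 2 * φ₀ ^ 2 / (4 * (n : ℝ) * r₁ ^ 2) := by positivity
    linarith
  have hk1' : k2 = 1 - M / (4 * n * r₁ ^ 2) := by
    rw [hk2, hMdef]; field_simp; ring
  have hk1 : k2 < 1 := by
    rw [hk1']
    have : 0 < M / (4 * n * r₁ ^ 2) := by positivity
    linarith
  have hDpos : ∀ r, r₀ ≤ r → 0 < 4 * r₁ ^ 2 * r ^ 2 - r₀ ^ 4 * φ₀ ^ 2 := by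
    intro r hr
    have h1 : r₀ ^ 2 ≤ r ^ 2 := pow_le_pow_left₀ hr0.le hr 2
    have h2 : 4 * r₁ ^ 2 * r ^ 2 - r₀ ^ 4 * φ₀ ^ 2
      = 4 * r₁ ^ 2 * (r ^ 2 - r₀ ^ 2) + r₀ ^ 2 * M := by rw [hMdef]; ring
    rw [h2]
    have : 0 < r₀ ^ 2 * M := by positivity
    have : 0 ≤ 4 * r₁ ^ 2 * (r ^ 2 - r₀ ^ 2) := mul_nonneg (by positivity) (by linarith)
    linarith
  have hPpos : ∀ r, r₀ < r → 0 < r ^ 2 - r₀ ^ 2 := by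
    intro r hr
    have := pow_lt_pow_left₀ hr hr0.le (two_ne_zero)
    linarith
  have hαd : ∀ r, r₀ < r → HasDerivAt α (2 * r₁ * r * r₀ * Real.sqrt M /
      ((4 * r₁ ^ 2 * r ^ 2 - r₀ ^ 4 * φ₀ ^ 2) * Real.sqrt (r ^ 2 - r₀ ^ 2))) r := by
    intro r hr
    have hD := hDpos r hr.le
    have hrp : 0 < r := hr0.trans hr
    have hp := hPpos r hr
    have hsq : HasDerivAt (fun r : ℝ => r ^ 2) (2 * r) r := by simpa using hasDerivAt_pow 2 r
    have hN' : HasDerivAt (fun r : ℝ => 4 * r₁ ^ 2 * r ^ 2 - 4 * r₀ ^ 2 * r₁ ^ 2)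
      (4 * r₁ ^ 2 * (2 * r)) r := (hsq.const_mul _).sub_const _
    have hD' : HasDerivAt (fun r : ℝ => 4 * r₁ ^ 2 * r ^ 2 - r₀ ^ 4 * φ₀ ^ 2)
      (4 * r₁ ^ 2 * (2 * r)) r := (hsq.const_mul _).sub_const _
    have hNe : 4 * r₁ ^ 2 * r ^ 2 - 4 * r₀ ^ 2 * r₁ ^ 2 = 4 * r₁ ^ 2 * (r ^ 2 - r₀ ^ 2) := by ring
    have hcos : 1 - (4 * r₁ ^ 2 * r ^ 2 - 4 * r₀ ^ 2 * r₁ ^ 2)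
        / (4 * r₁ ^ 2 * r ^ 2 - r₀ ^ 4 * φ₀ ^ 2)
        = r₀ ^ 2 * M / (4 * r₁ ^ 2 * r ^ 2 - r₀ ^ 4 * φ₀ ^ 2) := by
      rw [eq_div_iff hD.ne', sub_mul, div_mul_cancel₀ _ hD.ne', hMdef]; ring
    have hNpos : 0 < 4 * r₁ ^ 2 * r ^ 2 - 4 * r₀ ^ 2 * r₁ ^ 2 := by rw [hNe]; positivity
    have hQ : 0 < (4 * r₁ ^ 2 * r ^ 2 - 4 * r₀ ^ 2 * r₁ ^ 2)
        / (4 * r₁ ^ 2 * r ^ 2 - r₀ ^ 4 * φ₀ ^ 2) := div_pos hNpos hD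
    have hQ1 : (4 * r₁ ^ 2 * r ^ 2 - 4 * r₀ ^ 2 * r₁ ^ 2)
        / (4 * r₁ ^ 2 * r ^ 2 - r₀ ^ 4 * φ₀ ^ 2) < 1 := by
      have : 0 < r₀ ^ 2 * M / (4 * r₁ ^ 2 * r ^ 2 - r₀ ^ 4 * φ₀ ^ 2) := by positivity
      linarith
    have hs := (hN'.div hD' hD.ne').sqrt hQ.ne'
    have hs1 : Real.sqrt ((4 * r₁ ^ 2 * r ^ 2 - 4 * r₀ ^ 2 * r₁ ^ 2)
        / (4 * r₁ ^ 2 * r ^ 2 - r₀ ^ 4 * φ₀ ^ 2)) < 1 := by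
      rw [Real.sqrt_lt' one_pos]; simpa using hQ1
    have hs0 := Real.sqrt_pos.2 hQ
    have ha := (Real.hasDerivAt_arcsin (by linarith) hs1.ne).comp r hs
    have : α = Real.arcsin ∘ fun r => Real.sqrt ((4 * r₁ ^ 2 * r ^ 2 - 4 * r₀ ^ 2 * r₁ ^ 2)
        / (4 * r₁ ^ 2 * r ^ 2 - r₀ ^ 4 * φ₀ ^ 2)) := funext hα
    rw [this]
    refine ha.congr_deriv ?_
    simp only [Pi.div_apply]
    rw [Real.sq_sqrt hQ.le, hcos, hNe]
    rw [Real.sqrt_div (by positivity), Real.sqrt_div (by positivity),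
      Real.sqrt_mul (by positivity), Real.sqrt_mul (by positivity),
      show (4 * r₁ ^ 2 : ℝ) = (2 * r₁) ^ 2 by ring,
      Real.sqrt_sq (show 0 ≤ 2 * r₁ by positivity), Real.sqrt_sq hr0.le]
    rw [show (4 * r₁ ^ 2 : ℝ) = (2 * r₁) ^ 2 by ring] at hD
    have hDM : (2 * r₁) ^ 2 * r ^ 2 - r₀ ^ 4 * φ₀ ^ 2 - (2 * r₁) ^ 2 * (r ^ 2 - r₀ ^ 2)
        = r₀ ^ 2 * M := by rw [hMdef]; ring
    generalize (2 * r₁) ^ 2 * r ^ 2 - r₀ ^ 4 * φ₀ ^ 2 = D at *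
    generalize hpp : r ^ 2 - r₀ ^ 2 = p at *
    have e1 : Real.sqrt D ^ 2 = D := Real.sq_sqrt hD.le
    have e2 : Real.sqrt M ^ 2 = M := Real.sq_sqrt hM.le
    have p1 := Real.sqrt_pos.2 hD
    have p2 := Real.sqrt_pos.2 hM
    have p3 := Real.sqrt_pos.2 hp
    have : (2 * r₁) ^ 2 * (2 * r) * D - (2 * r₁) ^ 2 * p * ((2 * r₁) ^ 2 * (2 * r))
      = (2 * r₁) ^ 2 * (2 * r) * (r₀ ^ 2 * Real.sqrt M ^ 2) := by rw [e2, ← hDM]; ring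
    rw [this]
    generalize Real.sqrt D = d at *
    subst e1
    field_simp
    try ring
  have hkey : ∀ r, r₀ < r → Real.sqrt (1 - k2 * Real.sin (α r) ^ 2) =
      Real.sqrt M * Real.sqrt (r ^ 2 + (n - 1) * r₀ ^ 2) /
        (Real.sqrt n * Real.sqrt (4 * r₁ ^ 2 * r ^ 2 - r₀ ^ 4 * φ₀ ^ 2)) := by
    intro r hr
    have hD := hDpos r hr.le
    have hrp : 0 < r := hr0.trans hr
    have hp := hPpos r hr
    have hN : 0 ≤ 4 * r₁ ^ 2 * r ^ 2 - 4 * r₀ ^ 2 * r₁ ^ 2 := by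
      have : 0 < 4 * r₁ ^ 2 * (r ^ 2 - r₀ ^ 2) := by positivity
      linarith
    have hQ1 : (4 * r₁ ^ 2 * r ^ 2 - 4 * r₀ ^ 2 * r₁ ^ 2)
        / (4 * r₁ ^ 2 * r ^ 2 - r₀ ^ 4 * φ₀ ^ 2) ≤ 1 := by
      rw [div_le_one hD]
      have : 0 < r₀ ^ 2 * M := by positivity
      rw [hMdef] at this
      linarith
    have hs0 := Real.sqrt_nonneg ((4 * r₁ ^ 2 * r ^ 2 - 4 * r₀ ^ 2 * r₁ ^ 2)
        / (4 * r₁ ^ 2 * r ^ 2 - r₀ ^ 4 * φ₀ ^ 2))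
    rw [hα, Real.sin_arcsin (by linarith) (Real.sqrt_le_one.2 hQ1),
      Real.sq_sqrt (div_nonneg hN hD.le), ← Real.sqrt_mul hM.le, ← Real.sqrt_mul hn0.le,
      ← Real.sqrt_div (by positivity)]
    congr 1
    rw [hk1', hMdef]
    field_simp
    ring
  have hFd : ∀ r, r₀ < r → HasDerivAt (fun r => ellF (α r) k2)
      (2 * r₁ * r * r₀ * Real.sqrt n / (Real.sqrt (4 * r₁ ^ 2 * r ^ 2 - r₀ ^ 4 * φ₀ ^ 2) *
        Real.sqrt (r ^ 2 - r₀ ^ 2) * Real.sqrt (r ^ 2 + (n - 1) * r₀ ^ 2))) r := by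
    intro r hr
    have h := (ellF_deriv k2 hk0 hk1 (α r)).comp r (hαd r hr)
    refine h.congr_deriv ?_
    rw [hkey r hr]
    have hD := hDpos r hr.le
    have hrp : 0 < r := hr0.trans hr
    have hp := hPpos r hr
    have hq : 0 < r ^ 2 + (n - 1) * r₀ ^ 2 := by positivity
    generalize 4 * r₁ ^ 2 * r ^ 2 - r₀ ^ 4 * φ₀ ^ 2 = D at *
    have e1 : Real.sqrt D ^ 2 = D := Real.sq_sqrt hD.le
    have p1 := Real.sqrt_pos.2 hD
    have p2 := Real.sqrt_pos.2 hM
    have p3 := Real.sqrt_pos.2 hp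
    have p4 := Real.sqrt_pos.2 hq
    have p5 := Real.sqrt_pos.2 hn0
    generalize Real.sqrt D = d at *
    subst e1
    generalize Real.sqrt (r ^ 2 - r₀ ^ 2) = p at *
    generalize Real.sqrt (r ^ 2 + (n - 1) * r₀ ^ 2) = q at *
    field_simp
  have hEd : ∀ r, r₀ < r → HasDerivAt (fun r => ellE (α r) k2)
      (2 * r₁ * r * r₀ * M * Real.sqrt (r ^ 2 + (n - 1) * r₀ ^ 2) /
        (Real.sqrt n * (4 * r₁ ^ 2 * r ^ 2 - r₀ ^ 4 * φ₀ ^ 2) *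
        Real.sqrt (4 * r₁ ^ 2 * r ^ 2 - r₀ ^ 4 * φ₀ ^ 2) * Real.sqrt (r ^ 2 - r₀ ^ 2))) r := by
    intro r hr
    have h := (ellE_deriv k2 (α r)).comp r (hαd r hr)
    refine h.congr_deriv ?_
    rw [hkey r hr]
    have hD := hDpos r hr.le
    have hrp : 0 < r := hr0.trans hr
    have hp := hPpos r hr
    have hq : 0 < r ^ 2 + (n - 1) * r₀ ^ 2 := by positivity
    have e2 : Real.sqrt M ^ 2 = M := Real.sq_sqrt hM.le
    have p1 := Real.sqrt_pos.2 hD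
    have p2 := Real.sqrt_pos.2 hM
    have p3 := Real.sqrt_pos.2 hp
    have p4 := Real.sqrt_pos.2 hq
    have p5 := Real.sqrt_pos.2 hn0
    generalize 4 * r₁ ^ 2 * r ^ 2 - r₀ ^ 4 * φ₀ ^ 2 = D at *
    generalize Real.sqrt D = d at *
    generalize Real.sqrt (r ^ 2 - r₀ ^ 2) = p at *
    generalize Real.sqrt (r ^ 2 + (n - 1) * r₀ ^ 2) = q at *
    clear_value M
    generalize Real.sqrt M = m at *
    rw [← e2]
    field_simp
  have htgt : ∀ r, r₀ < r →
      Real.sqrt ((1 - r₀ ^ 4 * φ₀ ^ 2 / (4 * r₁ ^ 2 * r ^ 2)) * f r) =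
      Real.sqrt (4 * r₁ ^ 2 * r ^ 2 - r₀ ^ 4 * φ₀ ^ 2) *
        Real.sqrt (r ^ 2 - r₀ ^ 2) * Real.sqrt (r ^ 2 + (n - 1) * r₀ ^ 2) / (2 * r₁ * r ^ 3) := by
    intro r hr
    have hD := hDpos r hr.le
    have hrp : 0 < r := hr0.trans hr
    have hp := hPpos r hr
    have hq : 0 < r ^ 2 + (n - 1) * r₀ ^ 2 := by positivity
    rw [← Real.sqrt_mul hD.le, ← Real.sqrt_mul (by positivity),
      ← Real.sqrt_sq (show 0 ≤ 2 * r₁ * r ^ 3 by positivity), ← Real.sqrt_div (by positivity)]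
    congr 1
    rw [hf, hA', hB']
    field_simp
    ring
  have hG : ∀ r : ℝ, r ^ 4 + ((n : ℝ) - 2) * r₀ ^ 2 * r ^ 2 - B
      = (r ^ 2 - r₀ ^ 2) * (r ^ 2 + (n - 1) * r₀ ^ 2) := by
    intro r; rw [hB']; ring
  have hαc : ContinuousAt α r₀ := by
    rw [show α = _ from funext hα]
    refine Real.continuous_arcsin.continuousAt.comp ?_
    refine Real.continuous_sqrt.continuousAt.comp ?_
    exact ContinuousAt.div (by fun_prop) (by fun_prop) (hDpos r₀ le_rfl).ne'
  have hα0 : α r₀ = 0 := by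
    rw [hα, show 4 * r₁ ^ 2 * r₀ ^ 2 - 4 * r₀ ^ 2 * r₁ ^ 2 = 0 by ring]; simp
  have hFc : ContinuousAt (fun r => ellF (α r) k2) r₀ :=
    ContinuousAt.comp (f := α) (g := fun a => ellF a k2)
      (ellF_deriv k2 hk0 hk1 (α r₀)).continuousAt hαc
  have hEc : ContinuousAt (fun r => ellE (α r) k2) r₀ :=
    ContinuousAt.comp (f := α) (g := fun a => ellE a k2)
      (ellE_deriv k2 (α r₀)).continuousAt hαc
  have hF0 : ellF (α r₀) k2 = 0 := by rw [hα0]; simp [ellF]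
  have hE0 : ellE (α r₀) k2 = 0 := by rw [hα0]; simp [ellE]
  refine ⟨?_, ?_, ?_, ?_⟩
  · intro r hr
    have hD := hDpos r hr.le
    have hrp : 0 < r := hr0.trans hr
    have hp := hPpos r hr
    have hq : 0 < r ^ 2 + (n - 1) * r₀ ^ 2 := by positivity
    have hsq : HasDerivAt (fun r : ℝ => r ^ 2) (2 * r) r := by simpa using hasDerivAt_pow 2 r
    have hD' : HasDerivAt (fun r : ℝ => 4 * r₁ ^ 2 * r ^ 2 - r₀ ^ 4 * φ₀ ^ 2)
      (4 * r₁ ^ 2 * (2 * r)) r := (hsq.const_mul _).sub_const _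
    have hG' := ((hsq.sub_const (r₀ ^ 2)).mul (hsq.add_const (((n:ℝ) - 1) * r₀ ^ 2))).sqrt
      (by simpa using (mul_pos hp hq).ne')
    have hH := (hG'.const_mul (2 * r₁)).div (hD'.sqrt hD.ne') (Real.sqrt_pos.2 hD).ne'
    have hT := (((hH.sub ((hEd r hr).const_mul (Real.sqrt n * r₀))).add
      ((hFd r hr).const_mul (r₀ / Real.sqrt n))).const_mul (ε / r₁)).const_add t₁
    have hte : t = _ := funext ht
    simp only [hG] at hte
    rw [hte]
    refine hT.congr_deriv ?_
    rw [htgt r hr]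
    simp only [Pi.mul_apply]
    rw [Real.sqrt_mul hp.le]
    have hrel : 4 * r₁ ^ 2 * (r ^ 2 - r₀ ^ 2) + r₀ ^ 2 * M
      = 4 * r₁ ^ 2 * r ^ 2 - r₀ ^ 4 * φ₀ ^ 2 := by rw [hMdef]; ring
    have e1 := Real.sq_sqrt hD.le
    have e3 := Real.sq_sqrt hp.le
    have e4 := Real.sq_sqrt hq.le
    have e5 := Real.sq_sqrt hn0.le
    have p1 := Real.sqrt_pos.2 hD
    have p3 := Real.sqrt_pos.2 hp
    have p4 := Real.sqrt_pos.2 hq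
    have p5 := Real.sqrt_pos.2 hn0
    generalize Real.sqrt (4 * r₁ ^ 2 * r ^ 2 - r₀ ^ 4 * φ₀ ^ 2) = d at *
    generalize Real.sqrt (r ^ 2 - r₀ ^ 2) = p at *
    generalize Real.sqrt (r ^ 2 + (n - 1) * r₀ ^ 2) = q at *
    generalize Real.sqrt (n:ℝ) = s at *
    refine alg_aux r r₀ r₁ M p q d s ε _ _ _ hrp hr₁pos p3 p4 p1 p5 e1 e3 e4 (by linarith) ?_
    rw [e1, e3, hrel]
  · intro r hr
    have hD := hDpos r hr.le
    have hrp : 0 < r := hr0.trans hr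
    have hp := hPpos r hr
    have hq : 0 < r ^ 2 + (n - 1) * r₀ ^ 2 := by positivity
    have h := ((hFd r hr).const_mul (ε * r₀ * φ₀ / (Real.sqrt (n : ℝ) * r₁))).const_add φ₁
    rw [show φ = _ from funext hφ]
    refine h.congr_deriv ?_
    rw [htgt r hr]
    have p1 := Real.sqrt_pos.2 hD
    have p3 := Real.sqrt_pos.2 hp
    have p4 := Real.sqrt_pos.2 hq
    have p5 := Real.sqrt_pos.2 hn0
    generalize Real.sqrt (4 * r₁ ^ 2 * r ^ 2 - r₀ ^ 4 * φ₀ ^ 2) = d at *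
    generalize Real.sqrt (r ^ 2 - r₀ ^ 2) = p at *
    generalize Real.sqrt (r ^ 2 + (n - 1) * r₀ ^ 2) = q at *
    field_simp
  · have hc : ContinuousAt t r₀ := by
      rw [show t = _ from funext ht]
      have h1 : ContinuousAt (fun r => 2 * r₁ *
          Real.sqrt (r ^ 4 + ((n : ℝ) - 2) * r₀ ^ 2 * r ^ 2 - B)
          / Real.sqrt (4 * r₁ ^ 2 * r ^ 2 - r₀ ^ 4 * φ₀ ^ 2)) r₀ :=
        ContinuousAt.div (by fun_prop) (by fun_prop) (Real.sqrt_pos.2 (hDpos r₀ le_rfl)).ne'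
      exact (((h1.sub (hEc.const_mul _)).add (hFc.const_mul _)).const_mul _).const_add _
    have h0 : t r₀ = t₁ := by
      rw [ht, hG, hF0, hE0]; simp
    have := hc.tendsto.mono_left (nhdsWithin_le_nhds (s := Set.Ioi r₀))
    rwa [h0] at this
  · have hc : ContinuousAt φ r₀ := by
      rw [show φ = _ from funext hφ]
      exact (hFc.const_mul _).const_add _
    have h0 : φ r₀ = φ₁ := by
      rw [hφ, hF0]; simp
    have := hc.tendsto.mono_left (nhdsWithin_le_nhds (s := Set.Ioi r₀))
    rwa [h0] at this
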